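/- Assume in addition that k is algebraically closed and that S is an integral domain. Let A be a deformation quantization of A₁ over W(k). Then A[p^{−1}] is topologically simple; concretely, every two-sided ideal J of A such that A/J has no p-torsion (p·a ∈ J implies a ∈ J) and such that J is p-adically closed (⋂_{j≥1}(J + p^jA) = J) satisfies J = 0 or J = A. -/

import Mathlib

universe u

open scoped TensorProduct

/-- A symplectic Poisson structure on a commutative `k`-algebra `S`: a `k`-bilinear,
antisymmetric bracket which is a derivation in each argument, satisfies the Jacobi identity,
and is nondegenerate in the sense that the `S`-linear map `ι : Ω¹_{S/k} → Der_k(S,S)`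
determined by `ι(g·df) = g·{f,·}` is bijective. -/
structure SymplecticPoisson (k S : Type u) [CommRing k] [CommRing S] [Algebra k S] where
  bracket : S → S → S
  add_left : ∀ x y z : S, bracket (x + y) z = bracket x z + bracket y z
  smul_left : ∀ (c : k) (x z : S), bracket (c • x) z = c • bracket x z
  antisymm : ∀ x y : S, bracket x y = - bracket y x
  leibniz : ∀ x y z : S, bracket x (y * z) = bracket x y * z + y * bracket x z
  jacobi : ∀ x y z : S,
    bracket x (bracket y z) + bracket y (bracket z x) + bracket z (bracket x y) = 0
  nondeg : ∃ ι : KaehlerDifferential k S ≃ₗ[S] Derivation k S S,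
    ∀ f g x : S, ι (g • KaehlerDifferential.D k S f) x = g * bracket f x

/-- The natural map `A ⊗[S] Aᵐᵒᵖ → End_S(A)`, `a ⊗ b ↦ (x ↦ a·x·b)`. -/
noncomputable def mulLeftRightMap (S : Type u) (A : Type*) [CommRing S] [Ring A]
    [Algebra S A] : A ⊗[S] Aᵐᵒᵖ →ₗ[S] Module.End S A :=
  TensorProduct.lift <| LinearMap.mk₂ S
    (fun a b => (LinearMap.mulRight S b.unop) ∘ₗ (LinearMap.mulLeft S a))
    (fun a₁ a₂ b => by ext x; simp [add_mul])
    (fun s a b => by ext x; simp [smul_mul_assoc])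
    (fun a b₁ b₂ => by ext x; simp [mul_add])
    (fun s a b => by ext x; simp [mul_smul_comm])

/-- `A` is an Azumaya algebra over `S`: a finitely generated faithful projective `S`-module
such that the natural map `A ⊗[S] Aᵐᵒᵖ → End_S(A)` is bijective. -/
def IsAzumayaOver (S : Type u) (A : Type*) [CommRing S] [Ring A] [Algebra S A] : Prop :=
  Module.Finite S A ∧ Module.Projective S A ∧ FaithfulSMul S A ∧
    Function.Bijective (mulLeftRightMap S A)

section
open Polynomial

/-- General Leibniz rule for iterates of a derivation. -/
theorem Derivation.iterate_mul_eq_sum {k S : Type*} [CommRing k] [CommRing S] [Algebra k S]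
    (D : Derivation k S S) (n : ℕ) (f g : S) :
    D^[n] (f * g) = ∑ ij ∈ Finset.HasAntidiagonal.antidiagonal n,
      (n.choose ij.1 : S) * (D^[ij.1] f * D^[ij.2] g) := by
  induction n generalizing f g with
  | zero => simp
  | succ n ih =>
    rw [Finset.sum_antidiagonal_choose_succ_mul (fun i j => D^[i] f * D^[j] g),
      Function.iterate_succ_apply, D.leibniz, smul_eq_mul, smul_eq_mul, iterate_map_add, ih,
      mul_comm g, ih]
    congr 1
    refine Finset.sum_congr rfl fun ij hij => ?_
    rw [Function.iterate_succ_apply, Nat.choose_symm_of_eq_add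
      (Finset.HasAntidiagonal.mem_antidiagonal.1 hij).symm]

/-- In characteristic `p`, the `p`-th iterate of a derivation is a derivation. -/
noncomputable def Derivation.iterateChar (p : ℕ) [Fact p.Prime] {k S : Type*} [CommRing k] [CommRing S]
    [Algebra k S] [CharP S p] (D : Derivation k S S) : Derivation k S S :=
  Derivation.mk' ((D : S →ₗ[k] S) ^ p) fun f g => by
    have key := D.iterate_mul_eq_sum p f g
    have hp : p ≠ 0 := (Fact.out : p.Prime).ne_zero
    rw [Module.End.pow_apply, Module.End.pow_apply, Module.End.pow_apply]
    refine key.trans ?_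
    rw [Finset.Nat.sum_antidiagonal_eq_sum_range_succ_mk, Finset.sum_range_succ,
      Finset.sum_range_eq_add_Ico _ (Nat.pos_of_ne_zero hp), Finset.sum_eq_zero]
    · simp
      ring
    · intro i hi
      rw [Finset.mem_Ico] at hi
      have : ((p.choose i : ℕ) : S) = 0 := (CharP.cast_eq_zero_iff S p _).2
        ((Fact.out : p.Prime).dvd_choose_self (by omega) hi.2)
      simp [this]

theorem Derivation.iterateChar_apply (p : ℕ) [Fact p.Prime] {k S : Type*} [CommRing k] [CommRing S]
    [Algebra k S] [CharP S p] (D : Derivation k S S) (f : S) :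
    D.iterateChar p f = D^[p] f := by
  exact Module.End.pow_apply _ _ _

theorem Polynomial.coeff_pow_mul_derivative_of_charP (p : ℕ) [hp : Fact p.Prime] {S : Type*} [CommRing S]
    [CharP S p] (F : S[X]) :
    (F ^ (p - 1) * derivative F).coeff (p - 1) = F.coeff 1 ^ p := by
  let φ : MvPolynomial S ℤ →+* S := (MvPolynomial.aeval (id : S → S)).toRingHom
  have hφ : Function.Surjective φ := fun s => ⟨MvPolynomial.X s, by simp [φ]⟩
  obtain ⟨G, rfl⟩ := Polynomial.map_surjective φ hφ F
  have hp1 : p - 1 + 1 = p := Nat.sub_add_cancel hp.out.one_le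
  have h1 : (G ^ p).coeff p = (G ^ (p - 1) * derivative G).coeff (p - 1) := by
    have h := congrArg (fun q => q.coeff (p - 1)) (derivative_pow G p)
    simp only [coeff_derivative, hp1] at h
    rw [mul_assoc, coeff_C_mul] at h
    have hc : (p : MvPolynomial S ℤ) ≠ 0 := Nat.cast_ne_zero.2 hp.out.ne_zero
    apply mul_left_cancel₀ hc
    rw [← h, mul_comm, ← hp1]
    push_cast
    ring
  have h2 := congrArg φ h1
  rw [← Polynomial.coeff_map, ← Polynomial.coeff_map, Polynomial.map_mul, Polynomial.map_pow,
    Polynomial.map_pow, ← derivative_map] at h2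
  rw [← h2, ← Polynomial.map_frobenius_expand, Polynomial.coeff_map]
  have h3 := Polynomial.coeff_expand_mul hp.out.pos (Polynomial.map φ G) 1
  rw [one_mul] at h3
  rw [h3, frobenius_def]

section
variable (p : ℕ) {k S : Type*} [Field k] [CommRing S] [Algebra k S]

/-- The truncated Taylor polynomial `∑_{i < p} D^i f / i! T^i`. -/
noncomputable def Derivation.truncExp (D : Derivation k S S) (f : S) : S[X] :=
  ∑ i ∈ Finset.range p, monomial i (((i.factorial : k)⁻¹) • D^[i] f)

variable [hp : Fact p.Prime] [CharP k p]

theorem factorial_ne_zero_of_charP {i : ℕ} (hi : i < p) : ((i.factorial : ℕ) : k) ≠ 0 := fun h =>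
  (Nat.not_le.2 hi) ((hp.out.dvd_factorial).1 ((CharP.cast_eq_zero_iff k p _).1 h))

omit hp [CharP k p] in
theorem Derivation.coeff_truncExp (D : Derivation k S S) (f : S) {i : ℕ} (hi : i < p) :
    (D.truncExp p f).coeff i = ((i.factorial : k)⁻¹) • D^[i] f := by
  simp [truncExp, coeff_monomial, hi]

theorem Derivation.X_pow_dvd_truncExp_mul_sub (D : Derivation k S S) (f g : S) :
    X ^ p ∣ D.truncExp p (f * g) - D.truncExp p f * D.truncExp p g := by
  rw [X_pow_dvd_iff]
  intro n hn
  rw [coeff_sub, coeff_truncExp _ _ _ hn, coeff_mul, D.iterate_mul_eq_sum, Finset.smul_sum,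
    sub_eq_zero]
  refine Finset.sum_congr rfl fun ij hij => ?_
  rw [Finset.HasAntidiagonal.mem_antidiagonal] at hij
  rw [coeff_truncExp _ _ _ (by omega), coeff_truncExp _ _ _ (by omega), smul_mul_smul_comm,
    ← nsmul_eq_mul, ← Nat.cast_smul_eq_nsmul k, smul_smul]
  congr 1
  have h1 := factorial_ne_zero_of_charP (k := k) p (show ij.1 < p by omega)
  have h2 := factorial_ne_zero_of_charP (k := k) p (show ij.2 < p by omega)
  have h3 := factorial_ne_zero_of_charP (k := k) p hn
  have h4 := Nat.add_choose_mul_factorial_mul_factorial ij.1 ij.2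
  rw [hij, ← Nat.choose_symm_of_eq_add hij.symm] at h4
  have h5 := congrArg (Nat.cast : ℕ → k) h4
  push_cast at h5
  field_simp
  linear_combination h5

theorem Derivation.X_pow_dvd_truncExp_pow_sub (D : Derivation k S S) (f : S) (n : ℕ) :
    X ^ p ∣ D.truncExp p (f ^ (n + 1)) - D.truncExp p f ^ (n + 1) := by
  induction n with
  | zero => simp
  | succ n ih =>
    have h := D.X_pow_dvd_truncExp_mul_sub p (f ^ (n + 1)) f
    have h2 := (ih.mul_right (D.truncExp p f)).add h
    rw [sub_mul, ← pow_succ, ← pow_succ] at h2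
    convert h2 using 1
    abel

theorem Derivation.truncExp_apply_self (D : Derivation k S S) (f : S) :
    D.truncExp p (D f) = derivative (D.truncExp p f) +
      monomial (p - 1) ((((p - 1).factorial : k)⁻¹) • D^[p] f) := by
  have hp1 : p = (p - 1) + 1 := (Nat.sub_add_cancel hp.out.one_le).symm
  ext i
  rw [coeff_add, coeff_derivative, coeff_monomial]
  rcases lt_trichotomy i (p - 1) with hi | hi | hi
  · rw [coeff_truncExp _ _ _ (by omega), coeff_truncExp _ _ _ (by omega), if_neg (by omega),
      add_zero, Function.iterate_succ_apply, smul_mul_assoc]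
    have h1 := factorial_ne_zero_of_charP (k := k) p (show i + 1 < p by omega)
    have h2 := factorial_ne_zero_of_charP (k := k) p (show i < p by omega)
    have h3 : (D^[i] (D f)) * ((i : S) + 1) = ((i : k) + 1) • D^[i] (D f) := by
      rw [Algebra.smul_def]; push_cast; simp [mul_comm]
    rw [h3, smul_smul]
    congr 1
    rw [Nat.factorial_succ] at h1 ⊢
    push_cast at h1 ⊢
    have := left_ne_zero_of_mul h1
    field_simp
  · subst hi
    rw [coeff_truncExp _ _ _ (by omega), if_pos rfl, ← Function.iterate_succ_apply]
    have : (D.truncExp p f).coeff (p - 1 + 1) = 0 := by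
      simp only [truncExp, finsetSum_coeff, coeff_monomial]
      refine Finset.sum_eq_zero fun b hb => if_neg ?_
      have := Finset.mem_range.1 hb
      omega
    rw [this, zero_mul, zero_add, Nat.succ_eq_add_one, ← hp1]
  · have h0 : ∀ g j, p ≤ j → (D.truncExp p g).coeff j = 0 := by
      intro g j hj
      simp only [truncExp, finsetSum_coeff, coeff_monomial]
      refine Finset.sum_eq_zero fun b hb => if_neg ?_
      have := Finset.mem_range.1 hb
      omega
    rw [h0 _ _ (by omega), h0 _ _ (by omega), if_neg (by omega)]
    simp

/-- Katz's identity for the Cartier operator along a derivation. -/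
theorem Derivation.iterate_pow_mul_apply (hp2 : 2 < p) [CharP S p] (D : Derivation k S S) (f : S) :
    D^[p - 1] (f ^ (p - 1) * D f) = f ^ (p - 1) * D^[p] f - D f ^ p := by
  have hp1 : p - 1 < p := Nat.sub_lt hp.out.pos one_pos
  obtain ⟨n, hn⟩ : ∃ n, p - 1 = n + 1 := ⟨p - 2, by omega⟩
  have h1 := D.X_pow_dvd_truncExp_mul_sub p (f ^ (p - 1)) (D f)
  have h2 := D.X_pow_dvd_truncExp_pow_sub p f n
  rw [← hn] at h2
  have h3 := h1.add (h2.mul_right (D.truncExp p (D f)))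
  rw [X_pow_dvd_iff] at h3
  have h4 := h3 (p - 1) hp1
  rw [sub_mul, sub_add_sub_cancel, coeff_sub, coeff_truncExp _ _ _ hp1, sub_eq_zero,
    truncExp_apply_self, mul_add, coeff_add, coeff_pow_mul_derivative_of_charP,
    coeff_truncExp _ _ _ hp.out.one_lt] at h4
  have h5 : ((D.truncExp p f) ^ (p - 1) * monomial (p - 1)
      ((((p - 1).factorial : k)⁻¹) • D^[p] f)).coeff (p - 1) =
      f ^ (p - 1) * ((((p - 1).factorial : k)⁻¹) • D^[p] f) := by
    have := coeff_mul_monomial ((D.truncExp p f) ^ (p - 1)) (p - 1) 0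
      ((((p - 1).factorial : k)⁻¹) • D^[p] f)
    rw [zero_add] at this
    rw [this, coeff_zero_eq_eval_zero, eval_pow, ← coeff_zero_eq_eval_zero,
      coeff_truncExp _ _ _ hp.out.pos]
    simp
  have hw : (((p - 1).factorial : ℕ) : k) = -1 := by
    have := congrArg (ZMod.castHom dvd_rfl k : ZMod p →+* k) (ZMod.wilsons_lemma p)
    rwa [_root_.map_natCast, _root_.map_neg, _root_.map_one] at this
  rw [h5, hw] at h4
  simp at h4
  linear_combination -h4
end

section
variable (p : ℕ) [hp : Fact p.Prime] {k R : Type*} [Field k] [CharP k p] [CommRing R] [Algebra k R]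

omit [CharP k p] in
/-- A derivation killing a set of ring generators, up to `p`-th powers, vanishes. -/
theorem Derivation.eq_zero_of_mem_closure [CharP R p] (D : Derivation k R R) {T : Set R}
    (hT : ∀ t ∈ T, D t = 0) {r : R}
    (hr : r ∈ Subring.closure (Set.range (frobenius R p) ∪ T)) : D r = 0 := by
  induction hr using Subring.closure_induction with
  | mem r hr =>
    rcases hr with ⟨s, rfl⟩ | hr
    · simp [frobenius_def]
    · exact hT r hr
  | zero => simp
  | one => simp
  | add a b _ _ ha hb => simp [ha, hb]
  | neg a _ ha => simp [ha]
  | mul a b _ _ ha hb => simp [ha, hb]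

omit [CharP k p] hp in
theorem Derivation.iterate_mul_pow {D : Derivation k R R} {x b : R} (hx : D x = 1) (hb : D b = 0)
    (a m : ℕ) : D^[m] (b * x ^ a) = (a.descFactorial m : R) * (b * x ^ (a - m)) := by
  induction m with
  | zero => simp
  | succ m ih =>
    rw [Function.iterate_succ_apply', ih, Nat.descFactorial_succ]
    simp only [leibniz, leibniz_pow, map_natCast, hx, hb, smul_eq_mul, mul_zero, add_zero,
      nsmul_eq_mul, mul_one, Nat.cast_mul, Nat.sub_sub]
    ring

/-- The truncated Taylor projection onto the constants of `D` along `x`. -/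
noncomputable def Derivation.taylorProj (D : Derivation k R R) (x g : R) : R :=
  ∑ j ∈ Finset.range p, ((j.factorial : k)⁻¹) • ((-x) ^ j * D^[j] g)

omit [CharP k p] hp in
theorem Derivation.taylorProj_add (D : Derivation k R R) (x g g' : R) :
    D.taylorProj p x (g + g') = D.taylorProj p x g + D.taylorProj p x g' := by
  simp only [taylorProj, iterate_map_add, mul_add, smul_add, Finset.sum_add_distrib]

omit [CharP k p] hp in
theorem Derivation.taylorProj_zero (D : Derivation k R R) (x : R) :
    D.taylorProj p x 0 = 0 := by
  simp [taylorProj, iterate_map_zero]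

omit [CharP k p] in
theorem Derivation.taylorProj_of_apply_eq_zero (D : Derivation k R R) (x : R) {g : R} (hg : D g = 0) :
    D.taylorProj p x g = g := by
  rw [taylorProj, Finset.sum_eq_single_of_mem 0 (Finset.mem_range.2 hp.out.pos)]
  · simp
  · intro j _ hj
    obtain ⟨i, rfl⟩ := Nat.exists_eq_succ_of_ne_zero hj
    rw [Function.iterate_succ_apply, hg, iterate_map_zero]
    simp

theorem Derivation.apply_taylorProj {D : Derivation k R R} {x : R} (hx : D x = 1)
    (hD : ∀ g, D^[p] g = 0) (g : R) : D (D.taylorProj p x g) = 0 := by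
  have key : ∀ n, n < p → D (∑ j ∈ Finset.range (n + 1),
      ((j.factorial : k)⁻¹) • ((-x) ^ j * D^[j] g)) =
      ((n.factorial : k)⁻¹) • ((-x) ^ n * D^[n + 1] g) := by
    intro n hn
    induction n with
    | zero => simp
    | succ n ih =>
      rw [Finset.sum_range_succ, map_add, ih (by omega)]
      have h1 := factorial_ne_zero_of_charP (k := k) p hn
      rw [Nat.factorial_succ] at h1 ⊢
      have h3 : ((n : k) + 1) ≠ 0 := by
        push_cast at h1
        exact left_ne_zero_of_mul h1
      have h2 : (((n + 1) * n.factorial : ℕ) : k)⁻¹ • (((n : R) + 1)) =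
          algebraMap k R ((n.factorial : k)⁻¹) := by
        rw [Algebra.smul_def, show (n : R) + 1 = algebraMap k R ((n : k) + 1) by simp, ← _root_.map_mul]
        congr 1
        push_cast
        field_simp
      simp only [map_smul, leibniz, leibniz_pow, map_neg, hx, smul_eq_mul, nsmul_eq_mul,
        Nat.add_sub_cancel, ← Function.iterate_succ_apply' D, Nat.succ_eq_add_one, smul_add]
      have h4 : ((((n + 1) * n.factorial : ℕ) : k)⁻¹) •
          (D^[n + 1] g * ((((n + 1 : ℕ) : R) * ((-x) ^ n * -1)))) =
          - (((n.factorial : k)⁻¹) • ((-x) ^ n * D^[n + 1] g)) := by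
        rw [Algebra.smul_def ((n.factorial : k)⁻¹), ← h2]
        simp only [Algebra.smul_def]
        push_cast
        ring
      rw [h4]
      abel
  have h := key (p - 1) (Nat.sub_lt hp.out.pos one_pos)
  rw [Nat.sub_add_cancel hp.out.one_le, hD] at h
  rw [taylorProj, h]
  simp

omit [CharP k p] hp in
theorem Derivation.comm_taylorProj {D E : Derivation k R R} {x : R} (hx : E x = 0)
    (hDE : ∀ g, E (D g) = D (E g)) (g : R) :
    E (D.taylorProj p x g) = D.taylorProj p x (E g) := by
  have hit : ∀ (j : ℕ) g, E (D^[j] g) = D^[j] (E g) := by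
    intro j
    induction j with
    | zero => simp
    | succ j ih => intro g; rw [Function.iterate_succ_apply', hDE, ih, Function.iterate_succ_apply']
  simp only [taylorProj, map_sum, map_smul, leibniz, leibniz_pow, hx, hit, map_neg, smul_eq_mul]
  simp

omit [CharP k p] in
theorem Derivation.taylorProj_sub_mem {D : Derivation k R R} {x g : R} {Q : Ideal R}
    (hQ : ∀ q ∈ Q, D q ∈ Q) (hg : D g ∈ Q) : D.taylorProj p x g - g ∈ Q := by
  have hit : ∀ j, D^[j + 1] g ∈ Q := by
    intro j
    induction j with
    | zero => simpa
    | succ j ih => rw [Function.iterate_succ_apply']; exact hQ _ ih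
  rw [taylorProj, Finset.sum_range_eq_add_Ico _ hp.out.pos]
  simp only [Nat.factorial_zero, Nat.cast_one, inv_one, pow_zero, Function.iterate_zero, id, one_mul,
    one_smul, add_sub_cancel_left]
  refine sum_mem fun j hj => ?_
  obtain ⟨i, rfl⟩ := Nat.exists_eq_succ_of_ne_zero (by have := Finset.mem_Ico.1 hj; omega : j ≠ 0)
  rw [Algebra.smul_def]
  exact Q.mul_mem_left _ (Q.mul_mem_left _ (hit i))

theorem Derivation.taylorProj_mul_pow_mem [CharP R p] {D : Derivation k R R} {x b : R} (hx : D x = 1)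
    {B : Subring R} (hB : Set.range (frobenius R p) ⊆ B) (hBD : ∀ b ∈ B, D b = 0) (hb : b ∈ B) (n : ℕ) :
    D.taylorProj p x (b * x ^ n) ∈ B := by
  have hxq : (x ^ (n / p)) ^ p ∈ B := hB ⟨x ^ (n / p), rfl⟩
  obtain ⟨b', hb', r, hr, h⟩ : ∃ b' ∈ B, ∃ r < p, b * x ^ n = b' * x ^ r := by
    refine ⟨b * (x ^ (n / p)) ^ p, B.mul_mem hb hxq, n % p, Nat.mod_lt _ hp.out.pos, ?_⟩
    rw [mul_assoc, ← pow_mul, ← pow_add, mul_comm (n / p), Nat.div_add_mod]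
  rw [h]
  have hterm : ∀ j < p, ((j.factorial : k)⁻¹) • ((-x) ^ j * D^[j] (b' * x ^ r)) =
      ((-1) ^ j * (r.choose j : R)) * (b' * x ^ r) := by
    intro j hj
    rw [iterate_mul_pow hx (hBD _ hb')]
    rcases le_or_gt j r with hjr | hjr
    · have h1 := factorial_ne_zero_of_charP (k := k) p hj
      have h2 : ((j.factorial : k)⁻¹) • (r.descFactorial j : R) = (r.choose j : R) := by
        rw [Nat.descFactorial_eq_factorial_mul_choose, Algebra.smul_def]
        push_cast
        rw [← mul_assoc, ← _root_.map_natCast (algebraMap k R) j.factorial,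
          ← _root_.map_mul, inv_mul_cancel₀ h1, _root_.map_one, one_mul]
      rw [← h2, neg_pow x, show x ^ r = x ^ j * x ^ (r - j) by rw [← pow_add]; congr 1; omega]
      simp only [Algebra.smul_def]
      ring
    · rw [Nat.choose_eq_zero_of_lt hjr, Nat.descFactorial_eq_zero_iff_lt.2 hjr]
      simp
  rw [taylorProj, Finset.sum_congr rfl fun j hj => hterm j (Finset.mem_range.1 hj), ← Finset.sum_mul]
  have hs : ∑ j ∈ Finset.range p, (-1 : R) ^ j * (r.choose j : R) = if r = 0 then 1 else 0 := by
    rw [← Finset.sum_subset (Finset.range_subset_range.2 hr : Finset.range (r + 1) ⊆ _)]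
    · have := congrArg (Int.cast : ℤ → R) (Int.alternating_sum_range_choose (n := r))
      push_cast at this
      exact this
    · intro j _ hj
      rw [Nat.choose_eq_zero_of_lt (by simpa using hj)]
      simp
  rw [hs]
  split_ifs with h0
  · subst h0; simpa using hb'
  · simp
end

/-- A system of coordinates: `∂ i` are derivations dual to the elements `x i`, and the `x i` generate
the ring over its subring of `p`-th powers. -/
structure IsPBasisWithDerivations (p : ℕ) [Fact p.Prime] {k R ι : Type*} [Field k] [CommRing R]
    [Algebra k R] [CharP R p] (x : ι → R) (δ : ι → Derivation k R R) : Prop where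
  apply_self : ∀ i, δ i (x i) = 1
  apply_of_ne : ∀ i j, i ≠ j → δ i (x j) = 0
  closure_eq_top : Subring.closure (Set.range (frobenius R p) ∪ Set.range x) = ⊤

namespace IsPBasisWithDerivations
variable {p : ℕ} [hp : Fact p.Prime] {k R ι : Type*} [Field k] [CharP k p] [CommRing R] [Algebra k R]
  [CharP R p] {x : ι → R} {δ : ι → Derivation k R R}

omit [CharP k p] in
theorem derivation_eq_zero (h : IsPBasisWithDerivations p x δ) (D : Derivation k R R)
    (hD : ∀ i, D (x i) = 0) (r : R) : D r = 0 :=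
  D.eq_zero_of_mem_closure p (T := Set.range x) (by rintro _ ⟨i, rfl⟩; exact hD i)
    (h.closure_eq_top ▸ Subring.mem_top r)

omit [CharP k p] in
theorem comm (h : IsPBasisWithDerivations p x δ) (i j : ι) (r : R) :
    δ i (δ j r) = δ j (δ i r) := by
  have key := h.derivation_eq_zero ⁅δ i, δ j⁆ (fun l => ?_) r
  · rwa [Derivation.commutator_apply, sub_eq_zero] at key
  · have h0 : ∀ i j, ∃ n : ℕ, δ i (x j) = n := fun i j => by
      by_cases hij : i = j
      · exact ⟨1, by subst hij; simp [h.apply_self]⟩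
      · exact ⟨0, by simp [h.apply_of_ne i j hij]⟩
    obtain ⟨n, hn⟩ := h0 i l
    obtain ⟨m, hm⟩ := h0 j l
    simp [Derivation.commutator_apply, hn, hm]

omit [CharP k p] in
theorem iterate_eq_zero (h : IsPBasisWithDerivations p x δ) (i : ι) (r : R) :
    (δ i)^[p] r = 0 := by
  rw [← Derivation.iterateChar_apply]
  refine h.derivation_eq_zero _ (fun l => ?_) r
  rw [Derivation.iterateChar_apply]
  obtain ⟨n, hn⟩ : ∃ n : ℕ, δ i (x l) = n := by
    by_cases hij : i = l
    · exact ⟨1, by subst hij; simp [h.apply_self]⟩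
    · exact ⟨0, by simp [h.apply_of_ne i l hij]⟩
  obtain ⟨m, hm⟩ : ∃ m, p = m + 1 + 1 := ⟨p - 2, by have := hp.out.two_le; omega⟩
  rw [hm, Function.iterate_succ_apply, Function.iterate_succ_apply, hn, Derivation.map_natCast,
    iterate_map_zero]

/-- An element whose derivatives lie in a stable ideal is constant modulo that ideal. -/
theorem exists_sub_mem [Fintype ι] (h : IsPBasisWithDerivations p x δ) {Q : Ideal R}
    (hQ : ∀ i, ∀ q ∈ Q, δ i q ∈ Q) {g : R} (hg : ∀ i, δ i g ∈ Q) :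
    ∃ v, v - g ∈ Q ∧ ∀ i, δ i v = 0 := by
  classical
  suffices ∀ s : Finset ι, ∃ v, v - g ∈ Q ∧ ∀ i ∈ s, δ i v = 0 by
    simpa using this Finset.univ
  intro s
  induction s using Finset.induction_on with
  | empty => exact ⟨g, by simp⟩
  | insert i s his ih =>
    obtain ⟨v, hv, hv0⟩ := ih
    have hvi : δ i v ∈ Q := by
      have := Q.add_mem (hQ i _ hv) (hg i)
      rwa [← map_add, sub_add_cancel] at this
    refine ⟨(δ i).taylorProj p (x i) v, ?_, fun j hj => ?_⟩
    · rw [← sub_add_sub_cancel _ v]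
      exact Q.add_mem (Derivation.taylorProj_sub_mem p (hQ i) hvi) hv
    · rcases Finset.mem_insert.1 hj with rfl | hj
      · exact Derivation.apply_taylorProj p (h.apply_self j) (h.iterate_eq_zero j) v
      · rw [Derivation.comm_taylorProj p (h.apply_of_ne j i (fun e => his (e ▸ hj)))
          (h.comm j i), hv0 j hj, Derivation.taylorProj_zero]

/-- A stable ideal is generated by the constants it contains. -/
theorem mem_span_constants [Fintype ι] (h : IsPBasisWithDerivations p x δ) {Q : Ideal R}
    (hQ : ∀ i, ∀ q ∈ Q, δ i q ∈ Q) {g : R} (hg : g ∈ Q) :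
    g ∈ Ideal.span {v | v ∈ Q ∧ ∀ i, δ i v = 0} := by
  classical
  suffices ∀ s : Finset ι, g ∈ Ideal.span {v | v ∈ Q ∧ ∀ i ∈ s, δ i v = 0} by
    simpa using this Finset.univ
  intro s
  induction s using Finset.induction_on with
  | empty => exact Ideal.subset_span ⟨hg, by simp⟩
  | insert i s his ih =>
    refine Ideal.span_le.2 ?_ ih
    rintro v ⟨hv, hv0⟩
    suffices ∀ m ≤ p, ∀ v ∈ Q, (∀ j ∈ s, δ j v = 0) → (δ i)^[m] v = 0 →
        v ∈ Ideal.span {v | v ∈ Q ∧ ∀ j ∈ insert i s, δ j v = 0} from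
      this p le_rfl v hv hv0 (h.iterate_eq_zero i v)
    have hcomm : ∀ m j g, δ j ((δ i)^[m] g) = (δ i)^[m] (δ j g) := by
      intro m j
      induction m with
      | zero => simp
      | succ m ih =>
        intro g
        rw [Function.iterate_succ_apply', h.comm, ih, Function.iterate_succ_apply']
    intro m
    induction m with
    | zero =>
      rintro _ v _ _ h0
      rw [Function.iterate_zero, id] at h0
      simp [h0]
    | succ m ihm =>
      intro hm v hv hv0 hvm
      have hc : (δ i)^[m] v ∈ Q := by
        clear hvm ihm hm
        induction m with
        | zero => simpa
        | succ m ih => rw [Function.iterate_succ_apply']; exact hQ i _ ih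
      have hci : δ i ((δ i)^[m] v) = 0 := by rwa [← Function.iterate_succ_apply' (δ i)]
      have hcj : ∀ j ∈ s, δ j ((δ i)^[m] v) = 0 := fun j hj => by
        rw [hcomm, hv0 j hj, iterate_map_zero]
      have hfac := factorial_ne_zero_of_charP (k := k) p (Nat.lt_of_succ_le hm)
      have hcmem : (δ i)^[m] v ∈ Ideal.span {v | v ∈ Q ∧ ∀ j ∈ insert i s, δ j v = 0} :=
        Ideal.subset_span ⟨hc, fun j hj => (Finset.mem_insert.1 hj).elim
          (fun e => e ▸ hci) (hcj j)⟩
      rw [← sub_add_cancel v (((m.factorial : k)⁻¹) • ((δ i)^[m] v * x i ^ m))]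
      refine Ideal.add_mem _ (ihm (Nat.le_of_succ_le hm) _ ?_ ?_ ?_) ?_
      · refine Q.sub_mem hv ?_
        rw [Algebra.smul_def]
        exact Q.mul_mem_left _ (Q.mul_mem_right _ hc)
      · intro j hj
        rw [map_sub, hv0 j hj, Derivation.map_smul, Derivation.leibniz, hcj j hj,
          Derivation.leibniz_pow, h.apply_of_ne j i (fun e => his (e ▸ hj))]
        simp
      · have hsmul : ∀ (c : k) (z : R) (n : ℕ), (δ i)^[n] (c • z) = c • (δ i)^[n] z := by
          intro c z n
          induction n with
          | zero => rfl
          | succ n ih => rw [Function.iterate_succ_apply', ih, Derivation.map_smul, Function.iterate_succ_apply']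
        rw [iterate_map_sub, hsmul]
        refine sub_eq_zero.2 ?_
        rw [Derivation.iterate_mul_pow (h.apply_self i) hci m m]
        rw [Nat.descFactorial_self, Nat.sub_self, pow_zero, mul_one, Algebra.smul_def, ← mul_assoc,
          ← map_natCast (algebraMap k R), ← map_mul, inv_mul_cancel₀ hfac, map_one, one_mul]
      · rw [Algebra.smul_def]
        exact Ideal.mul_mem_left _ _ (Ideal.mul_mem_right _ _ hcmem)

/-- The constants are the `p`-th powers. -/
theorem exists_pow_eq [Fintype ι] (h : IsPBasisWithDerivations p x δ) {v : R}
    (hv : ∀ i, δ i v = 0) : ∃ u, u ^ p = v := by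
  classical
  suffices ∀ s : Finset ι, v ∈ Subring.closure (Set.range (frobenius R p) ∪ x '' s) →
      v ∈ Set.range (frobenius R p) by
    have := this Finset.univ (by
      rw [Finset.coe_univ, Set.image_univ, h.closure_eq_top]; exact Subring.mem_top v)
    exact this
  intro s
  induction s using Finset.induction_on with
  | empty =>
    intro hm
    rw [Finset.coe_empty, Set.image_empty, Set.union_empty, ← RingHom.coe_range,
      Subring.closure_eq] at hm
    exact hm
  | insert i s his ih =>
    intro hm
    apply ih
    set B := Subring.closure (Set.range (frobenius R p) ∪ x '' s) with hB
    have hBD : ∀ b ∈ B, δ i b = 0 := fun b hb =>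
      (δ i).eq_zero_of_mem_closure p (by
        rintro _ ⟨j, hj, rfl⟩
        exact h.apply_of_ne i j (fun e => his (e ▸ hj))) hb
    have hpoly : ∃ P : R[X], (∀ n, P.coeff n ∈ B) ∧ P.eval (x i) = v := by
      clear hv ih
      induction hm using Subring.closure_induction with
      | mem r hr =>
        have hC : r ∈ B → ∃ P : R[X], (∀ n, P.coeff n ∈ B) ∧ P.eval (x i) = r := fun hr =>
          ⟨C r, fun n => by rw [coeff_C]; split_ifs <;> simp [hr], by simp⟩
        rcases hr with hr | ⟨j, hj, rfl⟩
        · exact hC (Subring.subset_closure (Or.inl hr))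
        · rcases Finset.mem_insert.1 hj with rfl | hj
          · exact ⟨X, fun n => by rw [coeff_X]; split_ifs <;> simp, by simp⟩
          · exact hC (Subring.subset_closure (Or.inr ⟨j, hj, rfl⟩))
      | zero => exact ⟨0, by simp⟩
      | one => exact ⟨1, fun n => by rw [coeff_one]; split_ifs <;> simp, by simp⟩
      | add a b _ _ ha hb =>
        obtain ⟨P, hP, rfl⟩ := ha
        obtain ⟨P', hP', rfl⟩ := hb
        exact ⟨P + P', fun n => by rw [coeff_add]; exact B.add_mem (hP n) (hP' n), by simp⟩
      | neg a _ ha =>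
        obtain ⟨P, hP, rfl⟩ := ha
        exact ⟨-P, fun n => by rw [coeff_neg]; exact B.neg_mem (hP n), by simp⟩
      | mul a b _ _ ha hb =>
        obtain ⟨P, hP, rfl⟩ := ha
        obtain ⟨P', hP', rfl⟩ := hb
        exact ⟨P * P', fun n => by
          rw [coeff_mul]; exact sum_mem fun c _ => B.mul_mem (hP _) (hP' _), by simp⟩
    obtain ⟨P, hP, hPv⟩ := hpoly
    rw [← (δ i).taylorProj_of_apply_eq_zero p (x i) (hv i), ← hPv, eval_eq_sum_range]
    generalize Finset.range (P.natDegree + 1) = t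
    induction t using Finset.induction_on with
    | empty => simp [Derivation.taylorProj_zero]
    | insert n t hn iht =>
      rw [Finset.sum_insert hn, Derivation.taylorProj_add]
      exact B.add_mem (Derivation.taylorProj_mul_pow_mem p (h.apply_self i)
        (fun _ hr => Subring.subset_closure (Or.inl hr)) hBD (hP n) n) iht

end IsPBasisWithDerivations

section
variable (p : ℕ) [hp : Fact p.Prime]

/-- If every `p`-th power of `R` comes from `B`, then `R ⊗[B] R → R` has nilpotent kernel. -/
theorem TensorProduct.pow_char_eq_lmul'_tmul_one {B R : Type*} [CommRing B] [CommRing R]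
    [Algebra B R] [CharP B p] [CharP R p] [CharP (R ⊗[B] R) p]
    (hB : ∀ r : R, ∃ b : B, algebraMap B R b = r ^ p) (z : R ⊗[B] R) :
    z ^ p = ((Algebra.TensorProduct.lmul' B z) ^ p) ⊗ₜ[B] (1 : R) := by
  induction z with
  | zero => simp [hp.out.ne_zero]
  | add a b ha hb => rw [add_pow_char, map_add, add_pow_char, ha, hb, TensorProduct.add_tmul]
  | tmul a b =>
    obtain ⟨c, hc⟩ := hB b
    rw [Algebra.TensorProduct.tmul_pow, Algebra.TensorProduct.lmul'_apply_tmul, mul_pow, ← hc,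
      mul_comm, ← _root_.Algebra.smul_def, TensorProduct.smul_tmul, _root_.Algebra.smul_def, mul_one]

theorem Algebra.FormallyUnramified.surjective_of_pow_char {B R : Type*} [CommRing B] [CommRing R]
    [Nontrivial R] [Algebra B R] [Algebra.FiniteType B R] [Algebra.FormallyUnramified B R] [CharP B p]
    (hB : ∀ r : R, ∃ b : B, algebraMap B R b = r ^ p) : Function.Surjective (algebraMap B R) := by
  have hn : Nontrivial (R ⊗[B] R) :=
    (Algebra.TensorProduct.lmul' B (S := R)).toRingHom.domain_nontrivial
  have hR : ((p : ℕ) : R) = 0 := by rw [← map_natCast (algebraMap B R), CharP.cast_eq_zero, map_zero]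
  have hR2 : ((p : ℕ) : R ⊗[B] R) = 0 := by
    rw [← map_natCast (algebraMap B (R ⊗[B] R)), CharP.cast_eq_zero, map_zero]
  have : CharP R p := (CharP.charP_iff_prime_eq_zero hp.out).2 hR
  have : CharP (R ⊗[B] R) p := (CharP.charP_iff_prime_eq_zero hp.out).2 hR2
  have : Algebra.IsIntegral B R := ⟨fun r => by
    obtain ⟨b, hb⟩ := hB r
    exact .of_pow hp.out.pos (hb ▸ isIntegral_algebraMap)⟩
  have hfin : Module.Finite B R := Algebra.IsIntegral.finite
  have hu : IsUnit (Algebra.FormallyUnramified.elem B R) := by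
    refine IsUnit.of_pow_eq_one (n := p) ?_ hp.out.ne_zero
    rw [TensorProduct.pow_char_eq_lmul'_tmul_one p hB, lmul_elem, one_pow]
    rfl
  rw [← Algebra.isEpi_iff_surjective_algebraMap_of_finite, Algebra.isEpi_iff_forall_one_tmul_eq]
  exact fun a => hu.mul_right_cancel (one_tmul_mul_elem a)

variable {k R : Type*} [Field k] [CharP k p] [PerfectRing k p] [CommRing R] [Algebra k R] [CharP R p]
  [Nontrivial R]

theorem closure_eq_top_of_span_eq_top [Algebra.FiniteType k R] {I : Type*} (x : I → R)
    (hx : Submodule.span R (Set.range fun i => KaehlerDifferential.D k R (x i)) = ⊤) :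
    Subring.closure (Set.range (frobenius R p) ∪ Set.range x) = ⊤ := by
  set T : Set R := Set.range (frobenius R p) ∪ Set.range x
  let B : Subalgebra k R := Algebra.adjoin k T
  have hB : B.toSubring = Subring.closure T := by
    rw [Algebra.adjoin_eq_ring_closure]
    refine le_antisymm (Subring.closure_le.2 (Set.union_subset ?_ Subring.subset_closure))
      (Subring.closure_mono Set.subset_union_right)
    rintro _ ⟨c, rfl⟩
    refine Subring.subset_closure (Or.inl ⟨algebraMap k R ((frobeniusEquiv k p).symm c), ?_⟩)
    rw [frobenius_def, ← map_pow, frobeniusEquiv_symm_pow_p]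
  have : CharP B p := charP_of_injective_algebraMap (algebraMap k B).injective p
  have : Algebra.FiniteType B R := Algebra.FiniteType.of_restrictScalars_finiteType k B R
  have hsub : Subsingleton Ω[R⁄B] := by
    have h0 : ∀ ω, KaehlerDifferential.map k B R R ω = 0 := by
      intro ω
      have hω : ω ∈ Submodule.span R (Set.range fun i => KaehlerDifferential.D k R (x i)) :=
        hx ▸ Submodule.mem_top
      induction hω using Submodule.span_induction with
      | mem ω hω =>
        obtain ⟨i, rfl⟩ := hω
        rw [KaehlerDifferential.map_D]
        exact (KaehlerDifferential.D B R).map_algebraMap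
          (⟨x i, Algebra.subset_adjoin (Or.inr ⟨i, rfl⟩)⟩ : B)
      | zero => simp
      | add a b _ _ ha hb => rw [map_add, ha, hb, add_zero]
      | smul c a _ ha => rw [map_smul, ha, smul_zero]
    exact subsingleton_of_forall_eq 0 fun ω => by
      obtain ⟨ω, rfl⟩ := KaehlerDifferential.map_surjective k B R ω
      exact h0 ω
  have : Algebra.FormallyUnramified B R := ⟨hsub⟩
  have hsurj := Algebra.FormallyUnramified.surjective_of_pow_char p (B := B) (R := R) fun r =>
    ⟨⟨r ^ p, Algebra.subset_adjoin (Or.inl ⟨r, rfl⟩)⟩, rfl⟩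
  rw [← hB, eq_top_iff]
  intro r _
  obtain ⟨b, rfl⟩ := hsurj r
  exact b.2

theorem exists_isPBasisWithDerivations [Algebra.FiniteType k R] {I : Type*}
    (b : Module.Basis I R Ω[R⁄k]) (hb : Set.range b ⊆ Set.range (KaehlerDifferential.D k R)) :
    Finite I ∧ ∃ (x : I → R) (δ : I → Derivation k R R), IsPBasisWithDerivations p x δ := by
  refine ⟨Module.Finite.finite_basis b, ?_⟩
  choose x hx using fun i => hb ⟨i, rfl⟩
  classical
  have h : ∀ i j, (b.coord i).compDer (KaehlerDifferential.D k R) (x j) = if j = i then 1 else 0 := by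
    intro i j
    rw [Derivation.coe_comp]
    simp [hx, Finsupp.single_apply]
  refine ⟨x, fun i => (b.coord i).compDer (KaehlerDifferential.D k R), fun i => ?_, fun i j hij => ?_,
    closure_eq_top_of_span_eq_top (k := k) p x ?_⟩
  · rw [h, if_pos rfl]
  · rw [h, if_neg hij.symm]
  · simp_rw [hx]
    exact b.span_eq
end

/-- A smooth algebra over a perfect field has coordinates locally. -/
theorem exists_away_isPBasisWithDerivations (p : ℕ) [Fact p.Prime] {k S : Type*} [Field k] [CharP k p]
    [PerfectRing k p] [CommRing S] [IsDomain S] [Algebra k S] [Algebra.FiniteType k S]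
    [Algebra.FormallySmooth k S] (𝔫 : Ideal S) [𝔫.IsPrime] :
    ∃ h ∉ 𝔫, ∃ _ : CharP (Localization.Away h) p, ∃ (I : Type) (_ : Fintype I)
      (x : I → Localization.Away h) (δ : I → Derivation k (Localization.Away h) (Localization.Away h)),
      IsPBasisWithDerivations p x δ := by
  have : Algebra.FinitePresentation k S := Algebra.FinitePresentation.of_finiteType.1 inferInstance
  have : Algebra.Smooth k S := {}
  obtain ⟨h, hh, hs⟩ := Algebra.IsSmoothAt.exists_notMem_isStandardSmooth k 𝔫
  have h0 : h ≠ 0 := fun e => hh (e ▸ 𝔫.zero_mem)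
  have : Nontrivial (Localization.Away h) :=
    (IsLocalization.injective _ (powers_le_nonZeroDivisors_of_noZeroDivisors h0)).nontrivial
      (f := algebraMap S (Localization.Away h))
  have hc : CharP (Localization.Away h) p :=
    charP_of_injective_algebraMap (algebraMap k (Localization.Away h)).injective p
  have : Algebra.FiniteType S (Localization.Away h) :=
    IsLocalization.finiteType_of_monoid_fg (Submonoid.powers h) _
  have : Algebra.FiniteType k (Localization.Away h) := .trans ‹_› this
  have : Algebra.FinitePresentation k (Localization.Away h) :=
    Algebra.FinitePresentation.of_finiteType.1 inferInstance
  obtain ⟨_, I, b, hb⟩ := Algebra.IsStandardSmooth.iff_exists_basis_kaehlerDifferential.1 hs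
  obtain ⟨hI, x, δ, hx⟩ := exists_isPBasisWithDerivations p b hb
  exact ⟨h, hh, hc, I, Fintype.ofFinite I, x, δ, hx⟩

/-- An ideal stable under all `k`-derivations. -/
def Ideal.IsDerivationStable (k : Type*) {S : Type*} [CommRing k] [CommRing S] [Algebra k S]
    (Q : Ideal S) : Prop :=
  ∀ (D : Derivation k S S), ∀ q ∈ Q, D q ∈ Q

section
variable {k S : Type*} [Field k] [CommRing S] [Algebra k S]

section
variable [Algebra.FiniteType k S] [Algebra.FormallySmooth k S]
  {R : Type*} [CommRing R] [Algebra k R] [Algebra S R] [IsScalarTower k S R]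

theorem Derivation.apply_algebraMap_mem_map {Q : Ideal S} {s : S}
    (h : ∀ D : Derivation k S S, D s ∈ Q) (E : Derivation k R R) :
    E (algebraMap S R s) ∈ Q.map (algebraMap S R) := by
  obtain ⟨n, f, g, -, -, hfg⟩ := Module.Finite.exists_comp_eq_id_of_projective S Ω[S⁄k]
  let L : Ω[S⁄k] →ₗ[S] R := (E.compAlgebraMap S).liftKaehlerDifferential
  have h1 : E (algebraMap S R s) = L (KaehlerDifferential.D k S s) := by
    simp only [L, Derivation.liftKaehlerDifferential_comp_D]
    rfl
  have h2 : KaehlerDifferential.D k S s = f (g (KaehlerDifferential.D k S s)) :=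
    (LinearMap.congr_fun hfg _).symm
  rw [h1, h2, pi_eq_sum_univ' (g (KaehlerDifferential.D k S s)), map_sum, map_sum]
  refine sum_mem fun j _ => ?_
  rw [_root_.map_smul, _root_.map_smul, Algebra.smul_def]
  refine Ideal.mul_mem_right _ _ (Ideal.mem_map_of_mem _ ?_)
  exact h ((LinearMap.proj j ∘ₗ g).compDer (KaehlerDifferential.D k S))

theorem Ideal.IsDerivationStable.apply_mem_map {Q : Ideal S} (hQ : Q.IsDerivationStable k)
    (E : Derivation k R R) {r : R} (hr : r ∈ Q.map (algebraMap S R)) :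
    E r ∈ Q.map (algebraMap S R) := by
  induction hr using Submodule.span_induction with
  | mem r hr =>
    obtain ⟨q, hq, rfl⟩ := hr
    exact E.apply_algebraMap_mem_map fun D => hQ D q hq
  | zero => simp
  | add a b _ _ ha hb => rw [map_add]; exact add_mem ha hb
  | smul c a ha h =>
    rw [smul_eq_mul, Derivation.leibniz, smul_eq_mul, smul_eq_mul]
    exact add_mem (Ideal.mul_mem_left _ _ h) (Ideal.mul_mem_right _ _ ha)
end

variable (p : ℕ) [hp : Fact p.Prime] [CharP k p]

section
variable [PerfectRing k p] [IsDomain S] [Algebra.FiniteType k S] [Algebra.FormallySmooth k S]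

theorem Ideal.IsDerivationStable.exists_sub_pow_mem {Q : Ideal S} (hQ : Q.IsDerivationStable k)
    {g : S} (hg : ∀ D : Derivation k S S, D g ∈ Q) : ∃ u, g - u ^ p ∈ Q := by
  have : CharP S p := charP_of_injective_algebraMap (algebraMap k S).injective p
  let N : Ideal S :=
    { carrier := {h | ∃ u, h ^ p * g - u ^ p ∈ Q}
      zero_mem' := ⟨0, by simp [hp.out.ne_zero]⟩
      add_mem' := by
        rintro a b ⟨u, hu⟩ ⟨v, hv⟩
        refine ⟨u + v, ?_⟩
        rw [add_pow_char, add_pow_char]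
        convert! Q.add_mem hu hv using 1
        ring
      smul_mem' := by
        rintro c a ⟨u, hu⟩
        refine ⟨c * u, ?_⟩
        convert! Q.mul_mem_left (c ^ p) hu using 1
        simp only [smul_eq_mul]
        ring }
  suffices N = ⊤ by
    obtain ⟨u, hu⟩ : (1 : S) ∈ N := this ▸ Submodule.mem_top
    exact ⟨u, by simpa using hu⟩
  by_contra hN
  obtain ⟨𝔫, h𝔫, hle⟩ := Ideal.exists_le_maximal N hN
  obtain ⟨h, hh, _, I, _, x, δ, hx⟩ := exists_away_isPBasisWithDerivations p (k := k) 𝔫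
  have hst := fun i q => hQ.apply_mem_map (R := Localization.Away h) (δ i) (r := q)
  obtain ⟨v, hv, hv0⟩ := hx.exists_sub_mem (k := k) hst
    (g := algebraMap S _ g) fun i => (δ i).apply_algebraMap_mem_map hg
  obtain ⟨u, rfl⟩ := hx.exists_pow_eq hv0
  obtain ⟨m, s, hs⟩ := IsLocalization.Away.surj h u
  have hmem : algebraMap S (Localization.Away h) (s ^ p - (h ^ m) ^ p * g) ∈
      Q.map (algebraMap S (Localization.Away h)) := by
    have := Ideal.mul_mem_left _ ((algebraMap S (Localization.Away h) (h ^ m)) ^ p) hv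
    simp only [map_sub, map_mul, map_pow, ← hs] at this ⊢
    convert this using 1
    ring
  rw [IsLocalization.algebraMap_mem_map_algebraMap_iff (Submonoid.powers h)] at hmem
  obtain ⟨_, ⟨n, rfl⟩, hn⟩ := hmem
  refine hh (Ideal.IsPrime.mem_of_pow_mem h𝔫.isPrime (n + m) (hle ⟨h ^ n * s, ?_⟩))
  rw [← Q.neg_mem_iff]
  convert! Q.mul_mem_left ((h ^ n) ^ (p - 1)) hn using 1
  obtain ⟨q, hq⟩ : ∃ q, p = q + 1 := ⟨p - 1, (Nat.sub_add_cancel hp.out.one_le).symm⟩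
  rw [hq, Nat.add_sub_cancel]
  ring

theorem Ideal.IsDerivationStable.eq_bot {Q : Ideal S} (hQ : Q.IsDerivationStable k) (hQt : Q ≠ ⊤)
    (hrad : ∀ u, u ^ p ∈ Q → u ∈ Q) : Q = ⊥ := by
  obtain ⟨𝔫, h𝔫, hle⟩ := Ideal.exists_le_maximal Q hQt
  obtain ⟨h, hh, _, I, _, x, δ, hx⟩ := exists_away_isPBasisWithDerivations p (k := k) 𝔫
  have h0 : h ≠ 0 := fun e => hh (e ▸ 𝔫.zero_mem)
  have hpow : Submonoid.powers h ≤ nonZeroDivisors S := powers_le_nonZeroDivisors_of_noZeroDivisors h0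
  have : IsDomain (Localization.Away h) := IsLocalization.isDomain_of_le_nonZeroDivisors _ hpow
  have : IsNoetherianRing S := Algebra.FiniteType.isNoetherianRing k S
  have : IsNoetherianRing (Localization.Away h) :=
    IsLocalization.isNoetherianRing (Submonoid.powers h) _ inferInstance
  set Q' := Q.map (algebraMap S (Localization.Away h))
  have hrad' : ∀ u, u ^ p ∈ Q' → u ∈ Q' := by
    intro u hu
    obtain ⟨m, s, hs⟩ := IsLocalization.Away.surj h u
    have hmem : algebraMap S (Localization.Away h) (s ^ p) ∈ Q' := by
      rw [map_pow, ← hs, mul_pow]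
      exact Ideal.mul_mem_right _ _ hu
    rw [IsLocalization.algebraMap_mem_map_algebraMap_iff (Submonoid.powers h)] at hmem
    obtain ⟨_, ⟨n, rfl⟩, hn⟩ := hmem
    have hs' : h ^ n * s ∈ Q := hrad _ (by
      rw [mul_pow]
      convert Q.mul_mem_left ((h ^ n) ^ (p - 1)) hn using 1
      rw [← mul_assoc, ← pow_succ, Nat.sub_add_cancel hp.out.one_le])
    have hunit : IsUnit (algebraMap S (Localization.Away h) h) :=
      IsLocalization.Away.algebraMap_isUnit h
    have := Ideal.mem_map_of_mem (algebraMap S (Localization.Away h)) hs'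
    rw [map_mul, ← hs, map_pow, ← mul_assoc, mul_comm _ u, mul_assoc] at this
    exact (Ideal.mul_unit_mem_iff_mem _ ((hunit.pow n).mul (hunit.pow m))).1 this
  have hid : IsIdempotentElem Q' := by
    refine le_antisymm Ideal.mul_le_right fun q hq => ?_
    refine Ideal.span_le.2 ?_ (hx.mem_span_constants (k := k)
      (fun i q => hQ.apply_mem_map (δ i)) hq)
    rintro _ ⟨hv, hv0⟩
    obtain ⟨u, rfl⟩ := hx.exists_pow_eq hv0
    have hu := hrad' u hv
    obtain ⟨m, hm⟩ : ∃ m, p = m + 1 + 1 := ⟨p - 2, by have := hp.out.two_le; omega⟩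
    rw [SetLike.mem_coe, hm, pow_succ, pow_succ, mul_assoc]
    exact Ideal.mul_mem_left _ _ (Ideal.mul_mem_mul hu hu)
  rcases (Ideal.isIdempotentElem_iff_eq_bot_or_top Q' (IsNoetherian.noetherian Q')).1 hid with hb | ht
  · exact (Ideal.map_eq_bot_iff_of_injective (IsLocalization.injective _ hpow)).1 hb
  · exfalso
    have h1 : algebraMap S (Localization.Away h) 1 ∈ Q' := ht ▸ Submodule.mem_top
    rw [IsLocalization.algebraMap_mem_map_algebraMap_iff (Submonoid.powers h)] at h1
    obtain ⟨_, ⟨n, rfl⟩, hn⟩ := h1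
    exact hh (Ideal.IsPrime.mem_of_pow_mem h𝔫.isPrime n (hle (by simpa using hn)))
end

/-- The de Rham–Witt type differential of the ghost component of `f`, paired with `D`. -/
def Derivation.ghost (f : ℕ → S) (r : ℕ) (D : Derivation k S S) : S :=
  ∑ l ∈ Finset.range (r + 1), f l ^ (p ^ (r - l) - 1) * D (f l)

theorem Derivation.iterate_mul_of_apply_eq_zero {D : Derivation k S S} {c : S} (hc : D c = 0)
    (n : ℕ) (y : S) : D^[n] (c * y) = c * D^[n] y := by
  induction n generalizing y with
  | zero => rfl
  | succ n ih => rw [Function.iterate_succ_apply, leibniz, hc, smul_zero, add_zero, smul_eq_mul, ih,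
      Function.iterate_succ_apply]

theorem Derivation.iterate_sum {D : Derivation k S S} (n : ℕ) {ι : Type*} (s : Finset ι) (y : ι → S) :
    D^[n] (∑ i ∈ s, y i) = ∑ i ∈ s, D^[n] (y i) := by
  induction n with
  | zero => rfl
  | succ n ih => simp only [Function.iterate_succ_apply', ih, map_sum]

theorem Derivation.iterate_ghost_succ [CharP S p] (hp2 : 2 < p) (f : ℕ → S) (r : ℕ)
    (D : Derivation k S S) :
    D^[p - 1] (D.ghost p f (r + 1)) = (D.iterateChar p).ghost p f (r + 1) - (D.ghost p f r) ^ p := by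
  have hD : ∀ c : S, D (c ^ p) = 0 := fun c => by simp
  have hone : D^[p - 1] (D (f (r + 1))) = D^[p] (f (r + 1)) := by
    rw [← Function.iterate_succ_apply, Nat.succ_eq_add_one, Nat.sub_add_cancel hp.out.one_le]
  rw [ghost, iterate_sum, ghost, Finset.sum_range_succ, Finset.sum_range_succ _ (r + 1), ghost,
    sum_pow_char]
  have hterm : ∀ l ∈ Finset.range (r + 1), D^[p - 1] (f l ^ (p ^ (r + 1 - l) - 1) * D (f l)) =
      f l ^ (p ^ (r + 1 - l) - 1) * D^[p] (f l) - (f l ^ (p ^ (r - l) - 1) * D (f l)) ^ p := by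
    intro l hl
    have hl' : r + 1 - l = (r - l) + 1 := by have := Finset.mem_range.1 hl; omega
    have he : p ^ (r + 1 - l) - 1 = (p ^ (r - l) - 1) * p + (p - 1) := by
      rw [hl', pow_succ, Nat.sub_mul, one_mul]
      have h1 : 1 ≤ p ^ (r - l) := Nat.one_le_pow _ _ hp.out.pos
      have h2 : p ≤ p ^ (r - l) * p := Nat.le_mul_of_pos_left _ h1
      have h3 := hp.out.one_le
      omega
    rw [he, pow_add, pow_mul, mul_assoc, iterate_mul_of_apply_eq_zero (hD _),
      iterate_pow_mul_apply p hp2]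
    ring
  rw [Finset.sum_congr rfl hterm, Finset.sum_sub_distrib]
  simp only [iterateChar_apply, Nat.sub_self, pow_zero, one_mul, hone]
  ring

theorem Derivation.apply_mem_of_ghost_mem [CharP S p] (hp2 : 2 < p) (f : ℕ → S) (r : ℕ) (I : ℕ → Ideal S)
    (hI : ∀ n u, u ^ p ∈ I n → u ∈ I (n + 1)) (hst : ∀ n < r, (I n).IsDerivationStable k)
    (h : ∀ D : Derivation k S S, D.ghost p f r ∈ I 0) (D : Derivation k S S) : D (f 0) ∈ I r := by
  have key : ∀ j ≤ r, ∀ D : Derivation k S S, D.ghost p f (r - j) ∈ I j := by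
    intro j
    induction j with
    | zero => intro _; exact h
    | succ j ih =>
      intro hj D
      apply hI
      have hrj : r - j = r - (j + 1) + 1 := by omega
      have h1 := Derivation.iterate_ghost_succ p hp2 f (r - (j + 1)) D
      rw [← hrj] at h1
      have hit : ∀ n, D^[n] (D.ghost p f (r - j)) ∈ I j := by
        intro n
        induction n with
        | zero => exact ih (by omega) D
        | succ n ihn =>
          rw [Function.iterate_succ_apply']
          exact hst j (by omega) D _ ihn
      have h2 := (I j).sub_mem (ih (by omega) (D.iterateChar p)) (hit (p - 1))
      rw [h1] at h2
      simpa using h2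
  simpa [Derivation.ghost] using key r le_rfl D
end

section
variable {S : Type u} {B : Type*} [CommRing S] [Ring B] [Algebra S B]

theorem mulLeftRightMap_tmul (a : B) (b : Bᵐᵒᵖ) (x : B) :
    mulLeftRightMap S B (a ⊗ₜ b) x = a * x * b.unop := by
  simp [mulLeftRightMap]

variable {J : Ideal B} (hJ : ∀ x ∈ J, ∀ a : B, x * a ∈ J)

include hJ in
theorem mulLeftRightMap_apply_mem (t : B ⊗[S] Bᵐᵒᵖ) {x : B} (hx : x ∈ J) :
    mulLeftRightMap S B t x ∈ J := by
  induction t with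
  | zero => simp
  | add a b ha hb => rw [map_add]; exact J.add_mem ha hb
  | tmul a b => rw [mulLeftRightMap_tmul]; exact hJ _ (J.mul_mem_left _ hx) _

include hJ in
theorem mulLeftRightMap_apply_sub_mem (t : B ⊗[S] Bᵐᵒᵖ) {z : B} (hz : ∀ a, z * a - a * z ∈ J) :
    mulLeftRightMap S B t z - z * mulLeftRightMap S B t 1 ∈ J := by
  induction t with
  | zero => simp
  | add a b ha hb =>
    rw [map_add, LinearMap.add_apply, LinearMap.add_apply, mul_add, add_sub_add_comm]
    exact J.add_mem ha hb
  | tmul a b =>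
    rw [mulLeftRightMap_tmul, mulLeftRightMap_tmul]
    convert! J.neg_mem (hJ _ (hz a) b.unop) using 1
    noncomm_ring

namespace IsAzumayaOver
variable (h : IsAzumayaOver S B)

include h in
/-- The unit of an Azumaya algebra splits off. -/
theorem exists_apply_one : ∃ τ : B →ₗ[S] S, τ 1 = 1 := by
  obtain ⟨_, _, _, -⟩ := h
  obtain ⟨n, f, g, -, -, hfg⟩ := Module.Finite.exists_comp_eq_id_of_projective S B
  let 𝔞 : Ideal S := LinearMap.range (LinearMap.applyₗ (R := S) (M₂ := S) (1 : B))
  have h1 : (1 : B) ∈ 𝔞 • (⊤ : Submodule S B) := by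
    rw [show (1 : B) = f (g 1) from (LinearMap.congr_fun hfg 1).symm, pi_eq_sum_univ' (g 1), map_sum]
    refine sum_mem fun j _ => ?_
    rw [map_smul]
    exact Submodule.smul_mem_smul ⟨LinearMap.proj j ∘ₗ g, rfl⟩ Submodule.mem_top
  have htop : (⊤ : Submodule S B) ≤ 𝔞 • ⊤ := by
    intro a _
    have := Submodule.mem_map_of_mem (f := LinearMap.mulLeft S a) h1
    rw [Submodule.map_smul''] at this
    simpa using Submodule.smul_mono le_rfl le_top this
  obtain ⟨r, hr, hr0⟩ := Submodule.exists_sub_one_mem_and_smul_eq_zero_of_fg_of_le_smul 𝔞 ⊤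
    Module.Finite.fg_top htop
  have : r = 0 := FaithfulSMul.eq_of_smul_eq_smul (α := B) fun b => by
    rw [hr0 b Submodule.mem_top, zero_smul]
  rw [this, zero_sub, neg_mem_iff] at hr
  exact hr

include h hJ in
theorem algebraMap_apply_mem (φ : B →ₗ[S] S) {z : B} (hz : z ∈ J) : algebraMap S B (φ z) ∈ J := by
  obtain ⟨t, ht⟩ := h.2.2.2.2 (Algebra.linearMap S B ∘ₗ φ)
  have := mulLeftRightMap_apply_mem hJ t hz
  rwa [ht] at this

include h hJ in
theorem eq_bot_of_comap_eq_bot (hS : ∀ s, algebraMap S B s ∈ J → s = 0) {z : B} (hz : z ∈ J) :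
    z = 0 := by
  obtain ⟨_, _, _⟩ := id h
  obtain ⟨n, f, g, -, hg, -⟩ := Module.Finite.exists_comp_eq_id_of_projective S B
  refine hg (_root_.funext fun j => ?_)
  rw [map_zero]
  exact hS _ (h.algebraMap_apply_mem hJ (LinearMap.proj j ∘ₗ g) hz)

include h hJ in
/-- An element which is central modulo `J` is congruent to an element of the base. -/
theorem exists_sub_algebraMap_mem {z : B} (hz : ∀ a, z * a - a * z ∈ J) :
    ∃ s, z - algebraMap S B s ∈ J := by
  obtain ⟨τ, hτ⟩ := h.exists_apply_one
  obtain ⟨t, ht⟩ := h.2.2.2.2 (Algebra.linearMap S B ∘ₗ τ)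
  have := mulLeftRightMap_apply_sub_mem hJ t hz
  rw [ht] at this
  refine ⟨τ z, ?_⟩
  rw [← J.neg_mem_iff]
  simpa [hτ] using this

end IsAzumayaOver
end

section
variable {A : Type*} [Ring A]

theorem pow_mul_sub_mul_pow (u b : A) (n : ℕ) :
    u ^ n * b - b * u ^ n = ∑ i ∈ Finset.range n, u ^ i * (u * b - b * u) * u ^ (n - 1 - i) := by
  induction n with
  | zero => simp
  | succ n ih =>
    rw [Finset.sum_range_succ', show u ^ (n + 1) * b - b * u ^ (n + 1) =
      u * (u ^ n * b - b * u ^ n) + (u * b - b * u) * u ^ n by rw [pow_succ']; noncomm_ring, ih,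
      Finset.mul_sum]
    congr 1
    · refine Finset.sum_congr rfl fun i _ => ?_
      rw [pow_succ', show n + 1 - 1 - (i + 1) = n - 1 - i by omega]
      simp only [mul_assoc]
    · simp

variable {p : ℕ} {u : A} (hu : ∀ x, ∃ d, u * x - x * u = p • d)

include hu in
theorem exists_pow_mul_eq {c d : A} (hd : u * c - c * u = p • d) (i : ℕ) :
    ∃ e, u ^ i * c = c * u ^ i + (p * i) • (d * u ^ (i - 1)) + p ^ 2 • e := by
  induction i with
  | zero => exact ⟨0, by simp⟩
  | succ i ih =>
    obtain ⟨e, he⟩ := ih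
    obtain ⟨d', hd'⟩ := hu d
    refine ⟨i • (d' * u ^ (i - 1)) + u * e, ?_⟩
    have h1 : u * c = c * u + p • d := by rw [← hd]; abel
    have h2 : u * d = d * u + p • d' := by rw [← hd']; abel
    have h3 : (p * i) • (d * u * u ^ (i - 1)) = (p * i) • (d * u ^ i) := by
      cases i with
      | zero => simp
      | succ i => rw [mul_assoc, ← pow_succ', Nat.add_sub_cancel]
    rw [pow_succ', mul_assoc, he, mul_add, mul_add, ← mul_assoc, h1, mul_smul_comm, mul_smul_comm,
      ← mul_assoc u d, h2, add_mul, add_mul, smul_add, h3, smul_mul_assoc, smul_mul_assoc, mul_assoc,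
      ← pow_succ', Nat.add_sub_cancel]
    module

include hu in
theorem exists_sum_pow_mul_pow_eq (hp : Odd p) (c : A) : ∃ e,
    ∑ i ∈ Finset.range p, u ^ i * c * u ^ (p - 1 - i) = p • (c * u ^ (p - 1)) + p ^ 2 • e := by
  obtain ⟨d, hd⟩ := hu c
  choose e he using exists_pow_mul_eq hu hd
  obtain ⟨m, hm⟩ := hp
  have hsum : ∑ i ∈ Finset.range p, p * i = p ^ 2 * m := by
    rw [← Finset.mul_sum, Finset.sum_range_id, show p - 1 = m * 2 by omega, ← mul_assoc,
      Nat.mul_div_cancel _ two_pos]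
    ring
  have hterm : ∀ i ∈ Finset.range p, u ^ i * c * u ^ (p - 1 - i) =
      c * u ^ (p - 1) + (p * i) • (d * u ^ (p - 2)) + p ^ 2 • (e i * u ^ (p - 1 - i)) := by
    intro i hi
    have hi' := Finset.mem_range.1 hi
    rw [he, add_mul, add_mul, mul_assoc, ← pow_add, show i + (p - 1 - i) = p - 1 by omega,
      smul_mul_assoc, smul_mul_assoc]
    cases i with
    | zero => simp
    | succ i => rw [mul_assoc d, ← pow_add, show i + 1 - 1 + (p - 1 - (i + 1)) = p - 2 by omega]
  refine ⟨m • (d * u ^ (p - 2)) + ∑ i ∈ Finset.range p, e i * u ^ (p - 1 - i), ?_⟩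
  rw [Finset.sum_congr rfl hterm, Finset.sum_add_distrib, Finset.sum_add_distrib, ← Finset.sum_smul,
    hsum, ← Finset.smul_sum, Finset.sum_const, Finset.card_range, smul_add, smul_smul, add_assoc]
end

/-- `A` is a `p`-torsion-free lift of `B = A / pA`, the centre of `B` is the image of `S`, and the
commutator on `A` induces the given Poisson bracket on it. -/
structure SymplecticPoisson.IsLift {k S : Type u} [CommRing k] [CommRing S] [Algebra k S]
    (P : SymplecticPoisson k S) (p : ℕ) {A B : Type*} [Ring A] [Ring B] (σ : S →+* B) (π : A →+* B) :
    Prop where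
  commute : ∀ s b, Commute (σ s) b
  exists_of_central : ∀ z, (∀ b, z * b = b * z) → ∃ s, σ s = z
  surjective : Function.Surjective π
  exists_of_map_eq_zero : ∀ a, π a = 0 → ∃ b, a = p • b
  torsion_free : ∀ a : A, p • a = 0 → a = 0
  exists_bracket : ∀ a b s t, π a = σ s → π b = σ t →
    ∃ c, p • c = a * b - b * a ∧ π c = σ (P.bracket s t)

theorem SymplecticPoisson.derivation_induction {k S : Type u} [CommRing k] [CommRing S] [Algebra k S]
    (P : SymplecticPoisson k S) {M : Derivation k S S → Prop}
    (hham : ∀ t D, (∀ x, D x = - P.bracket x t) → M D)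
    (hzero : M 0) (hadd : ∀ D E, M D → M E → M (D + E)) (hsmul : ∀ (a : S) D, M D → M (a • D))
    (D : Derivation k S S) : M D := by
  obtain ⟨ι, hι⟩ := P.nondeg
  obtain ⟨ω, rfl⟩ := ι.surjective D
  have hω : ω ∈ Submodule.span S (Set.range (KaehlerDifferential.D k S)) := by
    rw [KaehlerDifferential.span_range_derivation]
    exact Submodule.mem_top
  induction hω using Submodule.span_induction with
  | mem ω hω =>
    obtain ⟨t, rfl⟩ := hω
    refine hham t _ fun x => ?_
    rw [← P.antisymm, ← one_mul (P.bracket t x), ← hι, one_smul]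
  | zero => rwa [map_zero]
  | add a b _ _ ha hb => rw [map_add]; exact hadd _ _ ha hb
  | smul c a _ ha => rw [map_smul]; exact hsmul _ _ ha

namespace SymplecticPoisson.IsLift
variable {p : ℕ} [hp : Fact p.Prime] {k S : Type u} [Field k] [CommRing S] [CharP S p]
  [Algebra k S]
  {P : SymplecticPoisson k S} {A B : Type*} [Ring A] [Ring B] {σ : S →+* B} {π : A →+* B}
  (h : P.IsLift p σ π)

omit hp in
theorem map_nsmul_eq_zero (σ : S →+* B) (π : A →+* B) (a : A) : π (p • a) = 0 := by
  rw [map_nsmul, nsmul_eq_mul, ← map_natCast σ, CharP.cast_eq_zero, map_zero, zero_mul]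

include h

omit hp [CharP S p] in
theorem pow_torsion_free (n : ℕ) {a : A} (ha : p ^ n • a = 0) : a = 0 := by
  induction n with
  | zero => simpa using ha
  | succ n ih => exact ih (h.torsion_free _ (by rwa [smul_smul, ← pow_succ']))

omit hp [CharP S p] in
theorem pow_smul_injective (n : ℕ) {a b : A} (hab : p ^ n • a = p ^ n • b) : a = b := by
  rw [← sub_eq_zero] at hab ⊢
  exact h.pow_torsion_free n (by rwa [smul_sub])

omit hp [CharP S p] in
theorem exists_commutator {y : A} {f : S} (hy : π y = σ f) (b : A) : ∃ c, y * b - b * y = p • c :=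
  h.exists_of_map_eq_zero _ (by rw [map_sub, map_mul, map_mul, hy, (h.commute f (π b)).eq, sub_self])

theorem exists_pow_commutator (hp2 : 2 < p) {y : A} {f : S} (hy : π y = σ f) (r : ℕ) (b : A) :
    ∃ c, y ^ p ^ r * b - b * y ^ p ^ r = p ^ (r + 1) • c ∧
      ∀ t, π b = σ t → π c = σ (f ^ (p ^ r - 1) * P.bracket f t) := by
  induction r with
  | zero =>
    obtain ⟨c, hc⟩ := h.exists_commutator hy b
    refine ⟨c, by simpa using hc, fun t ht => ?_⟩
    obtain ⟨c', hc', hc''⟩ := h.exists_bracket _ _ _ _ hy ht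
    rw [h.pow_smul_injective 1 (a := c) (b := c') (by rw [pow_one, hc', hc]), hc'']
    simp
  | succ r ih =>
    obtain ⟨c, hc, hct⟩ := ih
    have hu : π (y ^ p ^ r) = σ (f ^ p ^ r) := by rw [map_pow, map_pow, hy]
    obtain ⟨e, he⟩ := exists_sum_pow_mul_pow_eq (h.exists_commutator hu)
      (hp.out.odd_of_ne_two hp2.ne') c
    refine ⟨c * (y ^ p ^ r) ^ (p - 1) + p • e, ?_, fun t ht => ?_⟩
    · rw [pow_succ p r, pow_mul, pow_mul_sub_mul_pow, hc]
      simp only [mul_smul_comm, smul_mul_assoc]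
      rw [← Finset.smul_sum, he]
      module
    · rw [map_add, map_nsmul_eq_zero σ, add_zero, map_mul, hct t ht, map_pow, hu, ← map_pow, ← map_mul]
      congr 1
      have h1 : 1 ≤ p ^ r := Nat.one_le_pow _ _ hp.out.pos
      have h2 : p ^ (r + 1) - 1 = p ^ r - 1 + p ^ r * (p - 1) := by
        rw [Nat.mul_sub, mul_one, ← pow_succ]
        have : p ^ r ≤ p ^ (r + 1) := Nat.pow_le_pow_right hp.out.pos (Nat.le_succ r)
        omega
      rw [h2, pow_add, pow_mul]
      ring
omit h

/-- `w` is congruent modulo `p ^ (r + 1)` to the `r`-th ghost component of a sequence lifting `f`. -/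
def _root_.IsGhostLift (p : ℕ) (σ : S →+* B) (π : A →+* B) (r : ℕ) (f : ℕ → S) (w : A) : Prop :=
  ∃ (y : ℕ → A) (z : A), (∀ l, π (y l) = σ (f l)) ∧
    w = ∑ l ∈ Finset.range (r + 1), p ^ l • y l ^ p ^ (r - l) + p ^ (r + 1) • z

omit hp [CharP S p] in
theorem _root_.IsGhostLift.cons {r : ℕ} {f : ℕ → S} {w : A} (hw : IsGhostLift p σ π r f w) {y : A} {u : S}
    (hy : π y = σ u) :
    IsGhostLift p σ π (r + 1) (fun l => Nat.casesOn l u f) (y ^ p ^ (r + 1) + p • w) := by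
  obtain ⟨Y, z, hY, rfl⟩ := hw
  refine ⟨fun l => Nat.casesOn l y Y, z, fun l => ?_, ?_⟩
  · cases l with
    | zero => exact hy
    | succ l => exact hY l
  · rw [Finset.sum_range_succ' _ (r + 1)]
    simp only [pow_zero, one_smul, Nat.sub_zero, smul_add, Finset.smul_sum, smul_smul, ← pow_succ',
      Nat.add_sub_add_right]
    rw [← add_assoc, add_comm (y ^ _)]
    rfl

omit hp in
theorem _root_.IsGhostLift.map_eq {r : ℕ} {f : ℕ → S} {w : A} (hw : IsGhostLift p σ π r f w) :
    π w = σ (f 0 ^ p ^ r) := by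
  obtain ⟨y, z, hy, rfl⟩ := hw
  have h0 : ∀ (l : ℕ) (a : A), π (p ^ (l + 1) • a) = 0 := fun l a => by
    rw [pow_succ', mul_smul, map_nsmul_eq_zero σ]
  rw [Finset.sum_range_succ', map_add, map_add, map_sum, h0, Finset.sum_eq_zero fun l _ => h0 l _]
  simp [hy]

include h in
theorem sum_bracket_eq_zero (hp2 : 2 < p) {r : ℕ} {f : ℕ → S} {w : A} (hw : IsGhostLift p σ π r f w)
    (hc : ∀ b, ∃ c, w * b - b * w = p ^ (r + 2) • c) (t : S) :
    σ (∑ l ∈ Finset.range (r + 1), f l ^ (p ^ (r - l) - 1) * P.bracket (f l) t) = 0 := by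
  obtain ⟨y, z, hy, rfl⟩ := hw
  obtain ⟨b, hb⟩ := h.surjective (σ t)
  obtain ⟨c, hc⟩ := hc b
  obtain ⟨c', hc'⟩ := h.exists_commutator hb z
  choose d hd hdt using fun l => h.exists_pow_commutator hp2 (hy l) (r - l) b
  have hterm : ∀ l ∈ Finset.range (r + 1), p ^ l • y l ^ p ^ (r - l) * b - b * p ^ l • y l ^ p ^ (r - l) =
      p ^ (r + 1) • d l := by
    intro l hl
    rw [smul_mul_assoc, mul_smul_comm, ← smul_sub, hd, smul_smul, ← pow_add]
    congr 2
    have := Finset.mem_range.1 hl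
    omega
  rw [add_mul, mul_add, Finset.sum_mul, Finset.mul_sum, add_sub_add_comm, ← Finset.sum_sub_distrib,
    Finset.sum_congr rfl hterm, ← Finset.smul_sum, smul_mul_assoc, mul_smul_comm, ← smul_sub,
    ← neg_sub (b * z), hc', ← smul_add, show p ^ (r + 2) • c = p ^ (r + 1) • p • c by
      rw [smul_smul, ← pow_succ]] at hc
  have h1 := congrArg π (h.pow_smul_injective _ hc)
  rw [map_add, map_neg, map_nsmul_eq_zero σ, map_nsmul_eq_zero σ, neg_zero, add_zero, map_sum] at h1
  rw [map_sum, ← h1]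
  exact Finset.sum_congr rfl fun l _ => (hdt l t hb).symm

/-- The elements whose `p ^ n`-th power is killed by `σ`. -/
noncomputable def _root_.frobeniusKer (p : ℕ) [Fact p.Prime] [CharP S p] (σ : S →+* B) (n : ℕ) : Ideal S :=
  (RingHom.ker σ).comap (iterateFrobenius S p n)

theorem _root_.mem_frobeniusKer {n : ℕ} {f : S} : f ∈ frobeniusKer p σ n ↔ σ (f ^ p ^ n) = 0 := by
  rw [frobeniusKer, Ideal.mem_comap, iterateFrobenius_def, RingHom.mem_ker]

variable [CharP k p]

include h in
theorem apply_mem_frobeniusKer (hp2 : 2 < p) {r : ℕ} {f : ℕ → S} {w : A}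
    (hw : IsGhostLift p σ π r f w) (hc : ∀ b, ∃ c, w * b - b * w = p ^ (r + 2) • c)
    (hst : ∀ n < r, (frobeniusKer p σ n).IsDerivationStable k) (D : Derivation k S S) :
    D (f 0) ∈ frobeniusKer p σ r := by
  refine Derivation.apply_mem_of_ghost_mem p hp2 f r (frobeniusKer p σ) (fun n u hu => ?_) hst ?_ D
  · rw [mem_frobeniusKer] at hu ⊢
    rwa [pow_succ', pow_mul]
  · refine P.derivation_induction (fun t D hD => ?_) ?_ (fun D E hD hE => ?_) fun a D hD => ?_
    · have := h.sum_bracket_eq_zero hp2 hw hc t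
      rw [mem_frobeniusKer, pow_zero, pow_one, Derivation.ghost]
      simp only [hD, mul_neg, Finset.sum_neg_distrib]
      rw [map_neg, this, neg_zero]
    · simp [Derivation.ghost]
    · have := add_mem hD hE
      simpa only [Derivation.ghost, Derivation.add_apply, mul_add, Finset.sum_add_distrib] using this
    · have := Ideal.mul_mem_left _ a hD
      rw [Derivation.ghost, Finset.mul_sum] at this
      simpa only [Derivation.ghost, Derivation.smul_apply, smul_eq_mul, mul_left_comm a] using this

variable [PerfectRing k p] [IsDomain S] [Algebra.FiniteType k S] [Algebra.FormallySmooth k S]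

include h in
/-- Elements which are central modulo `p ^ (r + 1)` are ghost components. -/
theorem exists_isGhostLift (hp2 : 2 < p) (r : ℕ)
    (hst : ∀ n < r, (frobeniusKer p σ n).IsDerivationStable k) {a : A}
    (ha : ∀ b, ∃ c, a * b - b * a = p ^ (r + 1) • c) : ∃ f, IsGhostLift p σ π r f a := by
  induction r generalizing a with
  | zero =>
    obtain ⟨s, hs⟩ := h.exists_of_central (π a) fun b => by
      obtain ⟨b, rfl⟩ := h.surjective b
      obtain ⟨c, hc⟩ := ha b
      have := congrArg π hc
      rw [zero_add, pow_one, map_nsmul_eq_zero σ, map_sub, map_mul, map_mul, sub_eq_zero] at this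
      exact this
    exact ⟨fun _ => s, fun _ => a, 0, fun _ => hs.symm, by simp⟩
  | succ r ih =>
    have ih := @ih fun n hn => hst n (by omega)
    obtain ⟨f, hf⟩ := ih (a := a) fun b => by
      obtain ⟨c, hc⟩ := ha b
      exact ⟨p • c, by rw [hc, smul_smul, ← pow_succ]⟩
    obtain ⟨u, hu⟩ := (hst r (by omega)).exists_sub_pow_mem p
      (h.apply_mem_frobeniusKer hp2 hf ha fun n hn => hst n (by omega))
    obtain ⟨y, hy⟩ := h.surjective (σ u)
    have hay : π (a - y ^ p ^ (r + 1)) = 0 := by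
      rw [mem_frobeniusKer, sub_pow_char_pow, ← pow_mul, ← pow_succ', map_sub] at hu
      rw [map_sub, hf.map_eq, map_pow π, hy, ← map_pow, hu]
    obtain ⟨a', ha'⟩ := h.exists_of_map_eq_zero _ hay
    obtain ⟨g, hg⟩ := ih (a := a') fun b => by
      obtain ⟨c, hc⟩ := ha b
      obtain ⟨c', hc', -⟩ := h.exists_pow_commutator hp2 hy (r + 1) b
      refine ⟨c - c', h.pow_smul_injective 1 ?_⟩
      rw [pow_one, smul_sub, ← smul_mul_assoc, ← mul_smul_comm, ← ha', smul_smul, ← pow_succ', smul_sub,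
        ← hc, ← hc']
      noncomm_ring
    have := hg.cons hy
    rw [← ha', add_sub_cancel] at this
    exact ⟨_, this⟩

include h in
theorem isDerivationStable_frobeniusKer (hp2 : 2 < p) (n : ℕ) :
    (frobeniusKer p σ n).IsDerivationStable k := by
  induction n using Nat.strong_induction_on with
  | _ n ih =>
    intro D f hf
    suffices ∃ g : ℕ → S, IsGhostLift p σ π n g 0 ∧ g 0 = f by
      obtain ⟨g, hg, rfl⟩ := this
      exact h.apply_mem_frobeniusKer hp2 hg (fun b => ⟨0, by simp⟩) ih D
    rw [mem_frobeniusKer] at hf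
    cases n with
    | zero => exact ⟨fun _ => f, ⟨fun _ => 0, 0, fun _ => by simpa using hf.symm, by simp⟩, rfl⟩
    | succ n =>
      obtain ⟨y, hy⟩ := h.surjective (σ f)
      obtain ⟨a, ha⟩ := h.exists_of_map_eq_zero (-y ^ p ^ (n + 1)) (by
        rw [map_neg, map_pow, hy, ← map_pow, hf, neg_zero])
      obtain ⟨g, hg⟩ := h.exists_isGhostLift hp2 n (fun m hm => ih m (by omega)) (a := a) fun b => by
        obtain ⟨c, hc, -⟩ := h.exists_pow_commutator hp2 hy (n + 1) b
        refine ⟨-c, h.pow_smul_injective 1 ?_⟩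
        rw [pow_one, smul_sub, ← smul_mul_assoc, ← mul_smul_comm, ← ha, smul_smul, ← pow_succ', smul_neg,
          ← hc]
        noncomm_ring
      refine ⟨fun l => Nat.casesOn l f g, ?_, rfl⟩
      have := hg.cons hy
      rwa [← ha, add_neg_cancel] at this

include h in
/-- A torsion-free lift with nonzero reduction has faithful central reduction. -/
theorem injective [Nontrivial B] (hp2 : 2 < p) : Function.Injective σ := by
  have hmono : Monotone (frobeniusKer p σ) := monotone_nat_of_le_succ fun n f hf => by
    rw [mem_frobeniusKer] at hf ⊢
    rw [pow_succ, pow_mul, map_pow, hf, zero_pow hp.out.ne_zero]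
  have hmem : ∀ f, f ∈ ⨆ n, frobeniusKer p σ n ↔ ∃ n, σ (f ^ p ^ n) = 0 := fun f => by
    simp_rw [← mem_frobeniusKer]
    exact Submodule.mem_iSup_of_directed _ hmono.directed_le
  have hbot : ⨆ n, frobeniusKer p σ n = ⊥ := by
    refine Ideal.IsDerivationStable.eq_bot (k := k) p (fun D q hq => ?_) ?_ fun u hu => ?_
    · rw [hmem] at hq ⊢
      obtain ⟨n, hn⟩ := hq
      exact ⟨n, mem_frobeniusKer.1 (h.isDerivationStable_frobeniusKer hp2 n D q (mem_frobeniusKer.2 hn))⟩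
    · rw [Ne, Ideal.eq_top_iff_one, hmem]
      simp
    · rw [hmem] at hu ⊢
      obtain ⟨n, hn⟩ := hu
      exact ⟨n + 1, by rwa [pow_succ', pow_mul]⟩
  refine (injective_iff_map_eq_zero σ).2 fun f hf => ?_
  have : f ∈ ⨆ n, frobeniusKer p σ n := (hmem f).2 ⟨0, by simpa using hf⟩
  rwa [hbot] at this
end SymplecticPoisson.IsLift

theorem Ideal.eq_top_of_map_eq_one {A B : Type*} [Ring A] [Ring B] {π : A →+* B} {p : ℕ}
    (hker : ∀ a : A, π a = 0 → ∃ b : A, a = p * b) (J : Ideal A) (hJ : ∀ x ∈ J, ∀ a : A, x * a ∈ J)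
    (hclosed : ∀ a : A, (∀ j : ℕ, 1 ≤ j → ∃ b c : A, b ∈ J ∧ a = b + (p : A) ^ j * c) → a ∈ J)
    {x : A} (hx : x ∈ J) (hx1 : π x = 1) : J = ⊤ := by
  obtain ⟨c, hc⟩ := hker (1 - x) (by rw [map_sub, map_one, hx1, sub_self])
  refine (Ideal.eq_top_iff_one J).2 (hclosed 1 fun j _ => ⟨1 - (1 - x) ^ j, c ^ j, ?_, ?_⟩)
  · rw [← mul_neg_geom_sum, sub_sub_cancel]
    exact hJ _ hx _
  · rw [hc, (Nat.cast_commute p c).mul_pow, sub_add_cancel]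

theorem Ideal.eq_bot_of_forall_map_eq_zero {A B : Type*} [Ring A] [Ring B] {π : A →+* B} {p : ℕ}
    (hker : ∀ a : A, π a = 0 → ∃ b : A, a = p * b) (J : Ideal A)
    (hsep : ∀ a : A, (∀ j : ℕ, ∃ b : A, a = (p : A) ^ j * b) → a = 0)
    (htf : ∀ a : A, (p : A) * a ∈ J → a ∈ J) (hJ : ∀ x ∈ J, π x = 0) : J = ⊥ := by
  refine (Submodule.eq_bot_iff J).2 fun x hx => hsep x fun j => ?_
  suffices ∃ b ∈ J, x = (p : A) ^ j * b from this.imp fun _ => And.right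
  induction j with
  | zero => exact ⟨x, hx, by simp⟩
  | succ j ih =>
    obtain ⟨b, hb, rfl⟩ := ih
    obtain ⟨c, rfl⟩ := hker b (hJ b hb)
    exact ⟨c, htf c hb, by rw [pow_succ, mul_assoc]⟩

/-- The quotient of a quantization by a saturated two-sided ideal `J` lifts the quotient by the
reduction of `J`. -/
theorem SymplecticPoisson.isLift_quotient {k S : Type u} [CommRing k] [CommRing S] [Algebra k S]
    (P : SymplecticPoisson k S) {p : ℕ} {A B : Type*} [Ring A] [Ring B] [Algebra S B]
    (hAz : IsAzumayaOver S B)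
    {π : A →+* B} (hsurj : Function.Surjective π)
    (hker : ∀ a : A, π a = 0 ↔ ∃ b : A, a = (p : A) * b)
    (hbr : ∀ (a b : A) (s t : S), π a = algebraMap S B s → π b = algebraMap S B t →
      ∃ c : A, (p : A) * c = a * b - b * a ∧ π c = algebraMap S B (P.bracket s t))
    (J : Ideal A) [J.IsTwoSided] (htf : ∀ a : A, (p : A) * a ∈ J → a ∈ J)
    (I : Ideal B) [I.IsTwoSided] (hI : ∀ b, b ∈ I ↔ ∃ a ∈ J, π a = b) :
    P.IsLift p ((Ideal.Quotient.mk I).comp (algebraMap S B))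
      (Ideal.Quotient.lift J ((Ideal.Quotient.mk I).comp π) fun a ha =>
        Ideal.Quotient.eq_zero_iff_mem.2 ((hI _).2 ⟨a, ha, rfl⟩)) := by
  have hlift : ∀ a s, Ideal.Quotient.mk I (π a) = Ideal.Quotient.mk I (algebraMap S B s) →
      ∃ a', Ideal.Quotient.mk J a' = Ideal.Quotient.mk J a ∧ π a' = algebraMap S B s := by
    intro a s h
    obtain ⟨j, hj, hj'⟩ := (hI _).1 (Ideal.Quotient.eq.1 h)
    refine ⟨a - j, ?_, by rw [map_sub, hj', sub_sub_cancel]⟩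
    rw [map_sub, Ideal.Quotient.eq_zero_iff_mem.2 hj, sub_zero]
  refine ⟨fun s b => ?_, fun z hz => ?_, ?_, fun a ha => ?_, fun a ha => ?_, fun a b s t ha hb => ?_⟩
  · obtain ⟨b, rfl⟩ := Ideal.Quotient.mk_surjective b
    exact Commute.map (Algebra.commutes s b) (Ideal.Quotient.mk I)
  · obtain ⟨z, rfl⟩ := Ideal.Quotient.mk_surjective z
    obtain ⟨s, hs⟩ := hAz.exists_sub_algebraMap_mem (J := I) (fun x hx a => I.mul_mem_right a hx)
      (z := z) fun a => by
        rw [← Ideal.Quotient.eq, map_mul, map_mul]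
        exact hz _
    exact ⟨s, (Ideal.Quotient.eq.2 hs).symm⟩
  · exact Ideal.Quotient.lift_surjective_of_surjective _ _ (Ideal.Quotient.mk_surjective.comp hsurj)
  · obtain ⟨a, rfl⟩ := Ideal.Quotient.mk_surjective a
    obtain ⟨j, hj, hj'⟩ := (hI _).1 (Ideal.Quotient.eq_zero_iff_mem.1 ha)
    obtain ⟨b, hb⟩ := (hker (a - j)).1 (by rw [map_sub, hj', sub_self])
    refine ⟨Ideal.Quotient.mk J b, ?_⟩
    rw [nsmul_eq_mul, ← map_natCast (Ideal.Quotient.mk J), ← map_mul, ← hb, map_sub,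
      Ideal.Quotient.eq_zero_iff_mem.2 hj, sub_zero]
  · obtain ⟨a, rfl⟩ := Ideal.Quotient.mk_surjective a
    rw [nsmul_eq_mul, ← map_natCast (Ideal.Quotient.mk J), ← map_mul,
      Ideal.Quotient.eq_zero_iff_mem] at ha
    exact Ideal.Quotient.eq_zero_iff_mem.2 (htf a ha)
  · obtain ⟨a, rfl⟩ := Ideal.Quotient.mk_surjective a
    obtain ⟨b, rfl⟩ := Ideal.Quotient.mk_surjective b
    obtain ⟨a', ha', hs⟩ := hlift a s ha
    obtain ⟨b', hb', ht⟩ := hlift b t hb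
    obtain ⟨c, hc, hc'⟩ := hbr a' b' s t hs ht
    refine ⟨Ideal.Quotient.mk J c, ?_, congrArg (Ideal.Quotient.mk I) hc'⟩
    rw [← ha', ← hb', nsmul_eq_mul, ← map_natCast (Ideal.Quotient.mk J), ← map_mul, hc]
    simp only [map_sub, map_mul]

end

/-- Let `k` be an algebraically closed field of characteristic `p > 2`, `S` a
smooth affine symplectic `k`-algebra which is a domain, `A₁` an Azumaya algebra over
`S = Z(A₁)`, and `A` a deformation quantization of `A₁` over `W(k)` (a `p`-torsion-free,
`p`-adically separated and complete `W(k)`-algebra with structural surjection `π : A → A₁`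
having kernel `pA`). Then `A[p⁻¹]` is topologically simple: every two-sided ideal `J` of `A`
such that `A/J` has no `p`-torsion and such that `J` is `p`-adically closed satisfies `J = 0`
or `J = A`. -/
theorem stmt_6 (p : ℕ) [Fact p.Prime] (hp : 2 < p)
    (k : Type u) [Field k] [IsAlgClosed k] [CharP k p] [ExpChar k p] [PerfectRing k p]
    (S : Type u) [CommRing S] [IsDomain S] [Algebra k S]
    (hfg : Algebra.FiniteType k S) [Algebra.FormallySmooth k S]
    (P : SymplecticPoisson k S)
    (A₁ : Type*) [Ring A₁] [Algebra k A₁] [Algebra S A₁] [IsScalarTower k S A₁]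
    (hinj : Function.Injective (algebraMap S A₁))
    (hcen : Set.range (algebraMap S A₁) = (Subring.center A₁ : Set A₁))
    (hAz : IsAzumayaOver S A₁)
    (A : Type*) [Ring A] [Algebra (WittVector p k) A]
    (htf : ∀ a : A, (p : A) * a = 0 → a = 0)
    (hsep : ∀ a : A, (∀ j : ℕ, ∃ b : A, a = (p : A) ^ j * b) → a = 0)
    (hcomplete : ∀ f : ℕ → A, (∀ j : ℕ, ∃ b : A, f (j + 1) - f j = (p : A) ^ j * b) →
      ∃ a : A, ∀ j : ℕ, ∃ b : A, a - f j = (p : A) ^ j * b)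
    (π : A →+* A₁) (hsurj : Function.Surjective π)
    (hker : ∀ a : A, π a = 0 ↔ ∃ b : A, a = (p : A) * b)
    (hcompat : ∀ w : WittVector p k,
      π (algebraMap (WittVector p k) A w) = algebraMap k A₁ (w.coeff 0))
    (hbr : ∀ (a b : A) (s t : S), π a = algebraMap S A₁ s → π b = algebraMap S A₁ t →
      ∃ c : A, (p : A) * c = a * b - b * a ∧ π c = algebraMap S A₁ (P.bracket s t))
    (J : Ideal A) (hJ2 : ∀ x ∈ J, ∀ a : A, x * a ∈ J)
    (hJtf : ∀ a : A, (p : A) * a ∈ J → a ∈ J)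
    (hJclosed : ∀ a : A,
      (∀ j : ℕ, 1 ≤ j → ∃ b c : A, b ∈ J ∧ a = b + (p : A) ^ j * c) → a ∈ J) :
    J = ⊥ ∨ J = ⊤ := by
  have : J.IsTwoSided := ⟨fun a hx => hJ2 _ hx a⟩
  have hker' := fun a => (hker a).1
  let I : Ideal A₁ :=
    { carrier := {b | ∃ a ∈ J, π a = b}
      add_mem' := by
        rintro _ _ ⟨a, ha, rfl⟩ ⟨b, hb, rfl⟩
        exact ⟨a + b, J.add_mem ha hb, map_add π a b⟩
      zero_mem' := ⟨0, J.zero_mem, map_zero π⟩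
      smul_mem' := by
        rintro c _ ⟨a, ha, rfl⟩
        obtain ⟨c, rfl⟩ := hsurj c
        exact ⟨c * a, J.mul_mem_left c ha, map_mul π c a⟩ }
  have hI2 : ∀ x ∈ I, ∀ c, x * c ∈ I := by
    rintro _ ⟨a, ha, rfl⟩ c
    obtain ⟨c, rfl⟩ := hsurj c
    exact ⟨a * c, hJ2 a ha c, map_mul π a c⟩
  have : I.IsTwoSided := ⟨fun a hx => hI2 _ hx a⟩
  by_cases hI1 : (1 : A₁) ∈ I
  · obtain ⟨x, hx, hx1⟩ := hI1
    exact Or.inr (Ideal.eq_top_of_map_eq_one hker' J hJ2 hJclosed hx hx1)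
  · have : Nontrivial (A₁ ⧸ I) :=
      Ideal.Quotient.nontrivial_iff.2 fun h => hI1 (h ▸ Submodule.mem_top)
    have : CharP S p := charP_of_injective_algebraMap (algebraMap k S).injective p
    have hσ := (P.isLift_quotient hAz hsurj hker hbr J hJtf I fun b => Iff.rfl).injective hp
    refine Or.inl (Ideal.eq_bot_of_forall_map_eq_zero hker' J hsep hJtf fun x hx => ?_)
    refine hAz.eq_bot_of_comap_eq_bot hI2 (fun s hs => hσ ?_) (z := π x) ⟨x, hx, rfl⟩
    rw [map_zero]
    exact Ideal.Quotient.eq_zero_iff_mem.2 hs
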